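/- Kernel bias of the smoothed controlled-effect influence function (Theorem 6, continuous case, bias term): fix g ∈ {0,1} and m ∈ ℝ, and set τ̄ := E[δ(g,m,X) | G=1] and φ̄_h(g,m) := 1{G=g}·K_h(M − m)·(π(X)/(P(G=g|X)·f(m|g,X)))·(ΔY − δ(g,m,X))/p + (G/p)·(δ(g,m,X) − τ̄), where K_h(u) = h⁻¹K(u/h). Then, as h → 0⁺, E[φ̄_h(g,m)] = bias(g,m)·h² + o(h²), where bias(g,m) = (μ₂(K)/(2p))·E[ (π(X)/f(m|g,X)) · ∂²/∂v² { (δ(g,v,X) − δ(g,m,X))·f(v|g,X) } |_{v=m} ] and μ₂(K) = ∫ u² K(u) du. -/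

import Mathlib

open MeasureTheory Filter Topology

lemma aux_taylor (ψ ψ1 ψ2 : ℝ → ℝ) (h1 : ∀ v, HasDerivAt ψ (ψ1 v) v)
    (h2 : ∀ v, HasDerivAt ψ1 (ψ2 v) v) (m η ε : ℝ)
    (hη : ∀ v, |v - m| < η → |ψ2 v - ψ2 m| ≤ ε) (t : ℝ) (ht : |t| < η) :
    |ψ (m + t) - ψ m - ψ1 m * t - ψ2 m * t ^ 2 / 2| ≤ ε * t ^ 2 := by
  have hmem : ∀ s ∈ Set.uIcc 0 t, |s| ≤ |t| := by
    intro s hs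
    have := Set.abs_sub_left_of_mem_uIcc hs
    simpa using this
  have hε : 0 ≤ ε := le_trans (abs_nonneg _) (hη m (by simpa using lt_of_le_of_lt (abs_nonneg t) ht))
  have hd1 : ∀ s, HasDerivAt (fun s => ψ1 (m + s) - ψ2 m * s) (ψ2 (m + s) - ψ2 m) s := by
    intro s
    have := ((h2 (m + s)).comp_const_add m s).sub ((hasDerivAt_id s).const_mul (ψ2 m))
    rw [mul_one] at this
    exact this
  have b1 : ∀ s ∈ Set.uIcc 0 t, |ψ1 (m + s) - ψ1 m - ψ2 m * s| ≤ ε * |t| := by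
    intro s hs
    have := (convex_uIcc (0:ℝ) t).norm_image_sub_le_of_norm_hasDerivWithin_le
      (f := fun s => ψ1 (m + s) - ψ2 m * s) (C := ε)
      (fun x hx => (hd1 x).hasDerivWithinAt) (fun x hx => by
        rw [Real.norm_eq_abs]
        exact hη _ (by simpa using lt_of_le_of_lt (hmem x hx) ht)) Set.left_mem_uIcc hs
    simp only [Real.norm_eq_abs, add_zero, mul_zero, sub_zero] at this
    calc _ = |ψ1 (m + s) - ψ2 m * s - ψ1 m| := by congr 1; ring
      _ ≤ ε * |s| := this
      _ ≤ _ := mul_le_mul_of_nonneg_left (hmem s hs) hε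
  have hd0 : ∀ s, HasDerivAt (fun s => ψ (m + s) - ψ1 m * s - ψ2 m * s ^ 2 / 2)
      (ψ1 (m + s) - ψ1 m - ψ2 m * s) s := by
    intro s
    have := (((h1 (m + s)).comp_const_add m s).sub ((hasDerivAt_id s).const_mul (ψ1 m))).sub
      ((((hasDerivAt_id s).pow 2).const_mul (ψ2 m)).div_const 2)
    refine this.congr_deriv ?_
    simp only [id, mul_one]
    push_cast
    ring
  have := (convex_uIcc (0:ℝ) t).norm_image_sub_le_of_norm_hasDerivWithin_le
      (f := fun s => ψ (m + s) - ψ1 m * s - ψ2 m * s ^ 2 / 2) (C := ε * |t|)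
      (fun x hx => (hd0 x).hasDerivWithinAt) (fun x hx => by
        rw [Real.norm_eq_abs]
        exact b1 x hx) Set.left_mem_uIcc Set.right_mem_uIcc
  simp only [Real.norm_eq_abs, add_zero, mul_zero, sub_zero] at this
  calc _ = |ψ (m + t) - ψ1 m * t - ψ2 m * t ^ 2 / 2 - (ψ m - ψ2 m * 0 ^ 2 / 2)| := by
        congr 1; ring
    _ ≤ ε * |t| * |t| := this
    _ = _ := by rw [mul_assoc, abs_mul_abs_self, sq]

lemma aux_Kint (K : ℝ → ℝ) (hKmeas : Measurable K)
    (hKbdd : ∃ CK, ∀ u, |K u| ≤ CK) (hKsupp : HasCompactSupport K) (q : ℝ → ℝ)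
    (hq : Continuous q) : Integrable (fun u => K u * q u) := by
  obtain ⟨CK, hCK⟩ := hKbdd
  have h1 : Integrable (fun u => (tsupport K).indicator q u) :=
    (hq.continuousOn.integrableOn_compact hKsupp).integrable_indicator
      (isClosed_tsupport K).measurableSet
  have h2 := h1.bdd_mul (f := K) (c := CK) hKmeas.aestronglyMeasurable (ae_of_all _ hCK)
  refine h2.congr (ae_of_all _ fun u => ?_)
  by_cases hu : u ∈ tsupport K
  · simp [hu]
  · simp [hu, image_eq_zero_of_notMem_tsupport hu]

lemma aux_kernel (K : ℝ → ℝ) (hKmeas : Measurable K) (hKsymm : ∀ u, K (-u) = K u)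
    (hKbdd : ∃ CK, ∀ u, |K u| ≤ CK) (hKsupp : HasCompactSupport K)
    (B : ℝ) (hB : ∀ u, K u ≠ 0 → |u| ≤ B)
    (ψ ψ1 ψ2 : ℝ → ℝ) (h1 : ∀ v, HasDerivAt ψ (ψ1 v) v)
    (h2 : ∀ v, HasDerivAt ψ1 (ψ2 v) v) (m η ε : ℝ) (h0 : ψ m = 0)
    (hη : ∀ v, |v - m| < η → |ψ2 v - ψ2 m| ≤ ε) (h : ℝ) (hh : 0 < h) (hhB : h * B < η) :
    |(∫ v, (1 / h * K ((v - m) / h)) * ψ v) - h ^ 2 / 2 * ψ2 m * ∫ u, u ^ 2 * K u|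
      ≤ ε * h ^ 2 * ∫ u, u ^ 2 * |K u| := by
  have hcov : (∫ v, (1 / h * K ((v - m) / h)) * ψ v) = ∫ u, K u * ψ (m + h * u) := by
    have e1 := Measure.integral_comp_mul_left (fun w => (1 / h * K (w / h)) * ψ (m + w)) h
    have e2 := integral_add_left_eq_self (μ := volume)
      (fun v => (1 / h * K ((v - m) / h)) * ψ v) m
    simp only [add_sub_cancel_left] at e2
    rw [← e2]
    rw [abs_of_pos (inv_pos.2 hh), smul_eq_mul] at e1
    have e3 : ∀ x, 1 / h * K (h * x / h) * ψ (m + h * x) = h⁻¹ * (K x * ψ (m + h * x)) := by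
      intro x
      rw [mul_div_cancel_left₀ _ hh.ne']
      ring
    simp only [e3] at e1
    rw [integral_const_mul] at e1
    exact (mul_left_cancel₀ (inv_ne_zero hh.ne') e1).symm
  have hψc : Continuous ψ := continuous_iff_continuousAt.2 fun v => (h1 v).continuousAt
  have hodd : ∫ u, K u * u = 0 := by
    have := integral_neg_eq_self (fun u => K u * u) (volume : Measure ℝ)
    simp only [hKsymm, mul_neg, integral_neg] at this
    linarith
  have i1 : Integrable (fun u => K u * ψ (m + h * u)) :=
    aux_Kint K hKmeas hKbdd hKsupp _ (by fun_prop)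
  have i2 : Integrable (fun u => K u * u) :=
    aux_Kint K hKmeas hKbdd hKsupp _ (by fun_prop)
  have i3 : Integrable (fun u => u ^ 2 * K u) :=
    (aux_Kint K hKmeas hKbdd hKsupp (fun u => u ^ 2) (by fun_prop)).congr
      (ae_of_all _ fun u => by simp [mul_comm])
  have i4 : Integrable (fun u => u ^ 2 * |K u|) :=
    i3.abs.congr (ae_of_all _ fun u => by simp [abs_mul])
  have key : (∫ v, (1 / h * K ((v - m) / h)) * ψ v) - h ^ 2 / 2 * ψ2 m * ∫ u, u ^ 2 * K u
      = ∫ u, K u * (ψ (m + h * u) - ψ m - ψ1 m * (h * u) - ψ2 m * (h * u) ^ 2 / 2) := by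
    have : ∀ u, K u * (ψ (m + h * u) - ψ m - ψ1 m * (h * u) - ψ2 m * (h * u) ^ 2 / 2)
      = K u * ψ (m + h * u) - (ψ1 m * h) * (K u * u) - (h ^ 2 / 2 * ψ2 m) * (u ^ 2 * K u) := by
      intro u; rw [h0]; ring
    simp only [this]
    have e1 : Integrable (fun u => K u * ψ (m + h * u) - (ψ1 m * h) * (K u * u)) :=
      i1.sub (i2.const_mul _)
    rw [integral_sub e1 (i3.const_mul _),
      integral_sub i1 (i2.const_mul _), integral_const_mul, integral_const_mul, hodd, hcov]
    ring
  rw [key, ← integral_const_mul, ← Real.norm_eq_abs]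
  refine norm_integral_le_of_norm_le (i4.const_mul _) (ae_of_all _ fun u => ?_)
  rw [norm_mul, Real.norm_eq_abs, Real.norm_eq_abs]
  by_cases hu : K u = 0
  · simp [hu]
  have := aux_taylor ψ ψ1 ψ2 h1 h2 m η ε hη (h * u) (by
    rw [abs_mul, abs_of_pos hh]
    exact lt_of_le_of_lt (by gcongr; exact hB u hu) hhB)
  calc _ ≤ |K u| * (ε * (h * u) ^ 2) := by gcongr
    _ = _ := by ring


lemma aux_disint {Ω 𝓧 : Type*} [MeasurableSpace Ω] [MeasurableSpace 𝓧]
    (P : Measure Ω) [IsProbabilityMeasure P]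
    (G : Ω → ℝ) (hGmeas : Measurable G)
    (X : Ω → 𝓧) (hXmeas : Measurable X)
    (M : Ω → ℝ) (hMmeas : Measurable M)
    (g m : ℝ) 
    (c : ℝ) (hc : 0 < c)
    (pg : 𝓧 → ℝ) (hpgmeas : Measurable pg)
    (hpgc : ∀ᵐ ω ∂P, c ≤ pg (X ω)) (hpg1 : ∀ᵐ ω ∂P, pg (X ω) ≤ 1)
    (f : ℝ → 𝓧 → ℝ) (hfmeas : Measurable (fun p : ℝ × 𝓧 => f p.1 p.2))
    (hdens : ∀ h : ℝ → ℝ, Measurable h → (∃ C, ∀ v, |h v| ≤ C) →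
      (P[fun ω => h (M ω) * (if G ω = g then (1 : ℝ) else 0) |
          MeasurableSpace.comap X inferInstance]
        =ᵐ[P] fun ω => pg (X ω) * ∫ v, h v * f v (X ω)))
    (ε : ℝ) (hflow : ∀ᵐ ω ∂P, ∀ v, |v - m| ≤ ε → c ≤ f v (X ω))
    (C : ℝ) (hfC : ∀ x v, |f v x| ≤ C)
    (F : 𝓧 × ℝ → ℝ) (hF : Measurable F) (hF0 : ∀ x v, ¬ |v - m| ≤ ε → F (x, v) = 0)
    (C' : ℝ) (hFC : ∀ᵐ ω ∂P, |F (X ω, M ω)| ≤ C') :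
    ∫ ω, (if G ω = g then (1 : ℝ) else 0) * F (X ω, M ω) ∂P
      = ∫ ω, pg (X ω) * (∫ v, F (X ω, v) * f v (X ω)) ∂P := by
  set I : Set ℝ := {v | |v - m| ≤ ε} with hI
  have hIeq : I = Set.Icc (m - ε) (m + ε) := by
    ext v; simp only [hI, Set.mem_ofPred_eq, Set.mem_Icc, abs_le]
    constructor <;> rintro ⟨h1, h2⟩ <;> constructor <;> linarith
  have hIm : MeasurableSet I := by rw [hIeq]; exact measurableSet_Icc
  have hIfin : volume I < ⊤ := by rw [hIeq]; exact measure_Icc_lt_top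
  have hgset : MeasurableSet {ω | G ω = g} := hGmeas (measurableSet_singleton g)
  set S : Set Ω := {ω | G ω = g} ∩ M ⁻¹' I with hS
  have hSm : MeasurableSet S := hgset.inter (hMmeas hIm)
  set Q : Measure ℝ := volume.restrict I with hQ
  have : IsFiniteMeasure Q := ⟨by simpa [hQ] using hIfin⟩
  set d : Ω × ℝ → ENNReal := fun z => ENNReal.ofReal (pg (X z.1) * f z.2 (X z.1)) with hd
  have hfm' : Measurable (fun z : Ω × ℝ => f z.2 (X z.1)) :=
    hfmeas.comp (measurable_snd.prodMk (hXmeas.comp measurable_fst))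
  have hdm : Measurable d :=
    ((hpgmeas.comp (hXmeas.comp measurable_fst)).mul hfm').ennreal_ofReal
  have hXi : Measurable (fun z : Ω × ℝ => (X z.1, z.2)) :=
    (hXmeas.comp measurable_fst).prodMk measurable_snd
  have hXM : Measurable (fun ω => (X ω, M ω)) := hXmeas.prodMk hMmeas
  set ν1 : Measure (𝓧 × ℝ) := (P.restrict S).map (fun ω => (X ω, M ω)) with hν1
  set ν2 : Measure (𝓧 × ℝ) := ((P.prod Q).withDensity d).map (fun z => (X z.1, z.2)) with hν2
  have hle : MeasurableSpace.comap X inferInstance ≤ (inferInstance : MeasurableSpace Ω) :=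
    hXmeas.comap_le
  have hCnn : ∀ x : 𝓧, 0 ≤ C := fun x => (abs_nonneg _).trans (hfC x 0)
  have hν : ν1 = ν2 := by
    refine Measure.ext_prod fun {s t} hs ht => ?_
    have htI : MeasurableSet (t ∩ I) := ht.inter hIm
    set ind : ℝ → ℝ := (t ∩ I).indicator 1 with hind
    have hindm : Measurable ind := measurable_one.indicator htI
    have hindb : ∀ v, |ind v| ≤ 1 := by
      intro v; by_cases hv : v ∈ t ∩ I <;> simp [hind, hv]
    have hcond := hdens ind hindm ⟨1, hindb⟩
    have hsX : MeasurableSet (X ⁻¹' s) := hXmeas hs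
    have hfun : (fun ω => ind (M ω) * (if G ω = g then (1 : ℝ) else 0))
        = ({ω | G ω = g} ∩ M ⁻¹' (t ∩ I)).indicator 1 := by
      funext ω
      by_cases h1 : G ω = g
      · by_cases h2 : M ω ∈ t ∩ I
        · rw [Set.indicator_of_mem (show ω ∈ {ω | G ω = g} ∩ M ⁻¹' (t ∩ I) from ⟨h1, h2⟩), hind,
            Set.indicator_of_mem h2, if_pos h1]
          simp
        · rw [Set.indicator_of_notMem (fun h => h2 h.2), hind, Set.indicator_of_notMem h2]
          simp
      · rw [Set.indicator_of_notMem (fun h => h1 h.1), if_neg h1]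
        simp
    have hE : MeasurableSet ({ω | G ω = g} ∩ M ⁻¹' (t ∩ I)) := hgset.inter (hMmeas htI)
    have hint : Integrable (fun ω => ind (M ω) * (if G ω = g then (1 : ℝ) else 0)) P := by
      rw [hfun]; exact (integrable_const (1:ℝ)).indicator hE
    have e1 : ν1 (s ×ˢ t) = P (({ω | G ω = g} ∩ M ⁻¹' (t ∩ I)) ∩ X ⁻¹' s) := by
      rw [hν1, Measure.map_apply hXM (hs.prod ht), Measure.restrict_apply (hXM (hs.prod ht))]
      congr 1
      ext ω; simp [hS]; tauto
    have e2 : (P (({ω | G ω = g} ∩ M ⁻¹' (t ∩ I)) ∩ X ⁻¹' s)).toReal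
        = ∫ ω in X ⁻¹' s, pg (X ω) * (∫ v in t ∩ I, f v (X ω)) ∂P := by
      have a1 := setIntegral_condExp hle hint (s := X ⁻¹' s) ⟨s, hs, rfl⟩
      rw [hfun, integral_indicator_one hE] at a1
      rw [← hfun] at a1
      rw [measureReal_restrict_apply hE] at a1
      change P.real _ = _
      rw [← a1]
      refine integral_congr_ae (ae_restrict_of_ae (hcond.trans (ae_of_all _ fun ω => ?_)))
      simp only
      congr 1
      rw [← integral_indicator htI]
      congr 1; funext v
      by_cases hv : v ∈ t ∩ I <;> simp [hind, hv]
    have hfi : ∀ x, IntegrableOn (fun v => f v x) (t ∩ I) := by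
      intro x
      refine Measure.integrableOn_of_bounded (M := C)
        ((measure_mono Set.inter_subset_right).trans_lt hIfin).ne ?_
        (ae_of_all _ fun v => hfC x v)
      exact (hfmeas.comp (measurable_id.prodMk measurable_const)).aestronglyMeasurable
    have hnn : ∀ᵐ ω ∂P, 0 ≤ pg (X ω) * ∫ v in t ∩ I, f v (X ω) := by
      filter_upwards [hpgc, hflow] with ω h1 h2
      refine mul_nonneg (hc.le.trans h1) (setIntegral_nonneg htI fun v hv => hc.le.trans (h2 v hv.2))
    have hmeasInt : StronglyMeasurable (fun ω => ∫ v in t ∩ I, f v (X ω)) :=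
      hfm'.stronglyMeasurable.integral_prod_right' (ν := volume.restrict (t ∩ I))
    have hbd : Integrable (fun ω => pg (X ω) * ∫ v in t ∩ I, f v (X ω)) P := by
      refine Integrable.of_bound (C := 1 * (C * volume.real (t ∩ I)))
        ((hpgmeas.comp hXmeas).aestronglyMeasurable.mul hmeasInt.aestronglyMeasurable) ?_
      filter_upwards [hpgc, hpg1] with ω h1 h2
      rw [norm_mul]
      have b1 : ‖pg (X ω)‖ ≤ 1 := by rw [Real.norm_eq_abs, abs_le]; constructor <;> linarith
      have b2 : ‖∫ v in t ∩ I, f v (X ω)‖ ≤ C * volume.real (t ∩ I) :=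
        norm_setIntegral_le_of_norm_le_const
          ((measure_mono Set.inter_subset_right).trans_lt hIfin) (fun v _ => hfC _ v)
      exact mul_le_mul b1 b2 (norm_nonneg _) zero_le_one
    have e3 : ν2 (s ×ˢ t) = ENNReal.ofReal
        (∫ ω in X ⁻¹' s, pg (X ω) * (∫ v in t ∩ I, f v (X ω)) ∂P) := by
      rw [ofReal_integral_eq_lintegral_ofReal hbd.integrableOn (ae_restrict_of_ae hnn)]
      rw [hν2, Measure.map_apply hXi (hs.prod ht), withDensity_apply _ (hXi (hs.prod ht))]
      have : (fun z : Ω × ℝ => (X z.1, z.2)) ⁻¹' s ×ˢ t = (X ⁻¹' s) ×ˢ t := by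
        ext z; simp
      rw [this, ← Measure.prod_restrict, lintegral_prod _ hdm.aemeasurable]
      refine lintegral_congr_ae (ae_restrict_of_ae ?_)
      filter_upwards [hpgc, hflow] with ω h1 h2
      rw [hQ, Measure.restrict_restrict ht, ← integral_const_mul,
        ofReal_integral_eq_lintegral_ofReal ((hfi (X ω)).const_mul _)]
      filter_upwards [ae_restrict_mem htI] with v hv
      exact mul_nonneg (hc.le.trans h1) (hc.le.trans (h2 v hv.2))
    rw [e1, e3, ← e2, ENNReal.ofReal_toReal (measure_ne_top _ _)]
  have l1 : ∫ ω, (if G ω = g then (1 : ℝ) else 0) * F (X ω, M ω) ∂P = ∫ z, F z ∂ν1 := by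
    rw [hν1, integral_map hXM.aemeasurable hF.aestronglyMeasurable, ← integral_indicator hSm]
    congr 1; funext ω
    by_cases h1 : G ω = g
    · by_cases h2 : |M ω - m| ≤ ε
      · have : ω ∈ S := ⟨h1, h2⟩
        simp [h1, this]
      · have : ω ∉ S := fun h => h2 h.2
        simp [this, hF0 (X ω) (M ω) h2]
    · have : ω ∉ S := fun h => h1 h.1
      simp [h1, this]
  have hFint : Integrable F ν1 := by
    rw [hν1, integrable_map_measure hF.aestronglyMeasurable hXM.aemeasurable]
    exact Integrable.of_bound (C := C') (hF.comp hXM).aestronglyMeasurable (ae_restrict_of_ae hFC)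
  have hFint2 := hFint
  rw [hν, hν2, integrable_map_measure hF.aestronglyMeasurable hXi.aemeasurable,
    integrable_withDensity_iff_integrable_smul' hdm (ae_of_all _ fun _ => ENNReal.ofReal_lt_top)]
    at hFint2
  simp only [Function.comp_apply] at hFint2
  rw [l1, hν, hν2, integral_map hXi.aemeasurable hF.aestronglyMeasurable,
    integral_withDensity_eq_integral_toReal_smul hdm (ae_of_all _ fun _ => ENNReal.ofReal_lt_top),
    integral_prod _ hFint2]
  refine integral_congr_ae ?_
  filter_upwards [hpgc, hflow] with ω h1 h2
  rw [← integral_const_mul, hQ, ← integral_indicator hIm]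
  congr 1; funext v
  by_cases hv : |v - m| ≤ ε
  · have hv' : v ∈ I := hv
    simp only [hv', Set.indicator_of_mem, hd, smul_eq_mul]
    rw [ENNReal.toReal_ofReal (mul_nonneg (hc.le.trans h1) (hc.le.trans (h2 v hv)))]
    ring
  · have hv' : v ∉ I := hv
    simp [hv', hF0 (X ω) v hv]

lemma aux_derivs (q : ℝ → ℝ) (hq : ContDiff ℝ 2 q) :
    (∀ v, HasDerivAt q (iteratedDeriv 1 q v) v) ∧
    (∀ v, HasDerivAt (iteratedDeriv 1 q) (iteratedDeriv 2 q v) v) := by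
  constructor
  · intro v
    rw [iteratedDeriv_one]
    exact (hq.differentiable (by norm_num) v).hasDerivAt
  · intro v
    have h := (hq.differentiable_iteratedDeriv 1 (by norm_num) v).hasDerivAt
    rwa [← iteratedDeriv_succ] at h

lemma aux_tower {Ω 𝓧 : Type*} [MeasurableSpace Ω] [MeasurableSpace 𝓧]
    (P : Measure Ω) [IsProbabilityMeasure P]
    (G : Ω → ℝ) (hGmeas : Measurable G)
    (X : Ω → 𝓧) (hXmeas : Measurable X)
    (M : Ω → ℝ) (hMmeas : Measurable M)
    (ΔY : Ω → ℝ) (hΔYint : Integrable ΔY P)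
    (g : ℝ) (δ : ℝ → 𝓧 → ℝ)
    (hδver : (fun ω => (if G ω = g then (1 : ℝ) else 0) * δ (M ω) (X ω)) =ᵐ[P]
      fun ω => (if G ω = g then (1 : ℝ) else 0) *
        (P[ΔY | MeasurableSpace.comap (fun ω' => (G ω', M ω', X ω')) inferInstance]) ω)
    (B : 𝓧 × ℝ → ℝ) (hB : Measurable B)
    (C' : ℝ) (hBC : ∀ᵐ ω ∂P, |B (X ω, M ω)| ≤ C') :
    Integrable (fun ω => (if G ω = g then (1 : ℝ) else 0) * B (X ω, M ω) * ΔY ω) P ∧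
    ∫ ω, (if G ω = g then (1 : ℝ) else 0) * B (X ω, M ω) * ΔY ω ∂P =
    ∫ ω, (if G ω = g then (1 : ℝ) else 0) * B (X ω, M ω) * δ (M ω) (X ω) ∂P := by
  have hT : Measurable (fun ω' => (G ω', M ω', X ω')) := hGmeas.prodMk (hMmeas.prodMk hXmeas)
  set A : Ω → ℝ := fun ω => (if G ω = g then (1 : ℝ) else 0) * B (X ω, M ω) with hA
  have hR : Measurable (fun z : ℝ × ℝ × 𝓧 => (if z.1 = g then (1 : ℝ) else 0) * B (z.2.2, z.2.1)) :=
    (Measurable.ite (measurable_fst (measurableSet_singleton g)) measurable_const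
      measurable_const).mul (hB.comp (measurable_snd.snd.prodMk measurable_snd.fst))
  have hAm : StronglyMeasurable[MeasurableSpace.comap (fun ω' => (G ω', M ω', X ω')) inferInstance]
      A := by
    have := hR.comp (comap_measurable (fun ω' => (G ω', M ω', X ω')))
    exact this.stronglyMeasurable
  have hAm0 : Measurable A := hR.comp hT
  have hAb : ∀ᵐ ω ∂P, ‖A ω‖ ≤ C' := by
    filter_upwards [hBC] with ω h
    simp only [hA]
    by_cases h1 : G ω = g
    · simpa [h1] using h
    · simpa [h1] using (abs_nonneg _).trans h
  have hint : Integrable (A * ΔY) P := hΔYint.bdd_mul hAm0.aestronglyMeasurable hAb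
  refine ⟨hint, ?_⟩
  have h1 := condExp_mul_of_stronglyMeasurable_left hAm hint hΔYint
  have h2 := integral_condExp (μ := P) (f := A * ΔY) hT.comap_le
  change ∫ ω, (A * ΔY) ω ∂P = _
  rw [← h2]
  refine integral_congr_ae ?_
  filter_upwards [h1, hδver] with ω e1 e2
  rw [e1]
  simp only [Pi.mul_apply, hA]
  calc _ = B (X ω, M ω) * ((if G ω = g then (1 : ℝ) else 0) *
        (P[ΔY | MeasurableSpace.comap (fun ω' => (G ω', M ω', X ω')) inferInstance]) ω) := by ring
    _ = _ := by rw [← e2]; ring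

lemma aux_prod_derivs (d d1 d2 f f1 f2 : ℝ → ℝ) (a : ℝ)
    (hd : ∀ v, HasDerivAt d (d1 v) v) (hd1 : ∀ v, HasDerivAt d1 (d2 v) v)
    (hf : ∀ v, HasDerivAt f (f1 v) v) (hf1 : ∀ v, HasDerivAt f1 (f2 v) v) :
    (∀ v, HasDerivAt (fun v => (d v - a) * f v) (d1 v * f v + (d v - a) * f1 v) v) ∧
    (∀ v, HasDerivAt (fun v => d1 v * f v + (d v - a) * f1 v)
      ((d2 v * f v + d1 v * f1 v) + (d1 v * f1 v + (d v - a) * f2 v)) v) :=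
  ⟨fun v => ((hd v).sub_const a).mul (hf v),
   fun v => ((hd1 v).mul (hf v)).add (((hd v).sub_const a).mul (hf1 v))⟩

lemma aux_lip (q q1 : ℝ → ℝ) (hq : ∀ v, HasDerivAt q (q1 v) v) (C : ℝ) (hC : ∀ v, |q1 v| ≤ C)
    (v m : ℝ) : |q v - q m| ≤ C * |v - m| := by
  have := convex_univ.norm_image_sub_le_of_norm_hasDerivWithin_le (f := q) (C := C)
    (fun x _ => (hq x).hasDerivWithinAt) (fun x _ => hC x) (Set.mem_univ m) (Set.mem_univ v)
  exact this

lemma aux_psi2 (d1 d2 f f1 d2m d1m fm f1m dm dv f2 C r e : ℝ) (hC : 0 ≤ C)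
    (b1 : |f| ≤ C) (b2 : |d2m| ≤ C) (b3 : |d1| ≤ C) (b4 : |f1m| ≤ C) (b5 : |f2| ≤ C)
    (l1 : |f - fm| ≤ C * r) (l2 : |f1 - f1m| ≤ C * r) (l3 : |d1 - d1m| ≤ C * r)
    (l4 : |dv - dm| ≤ C * r) (l5 : |d2 - d2m| ≤ e) (f2m : ℝ) :
    |((d2 * f + d1 * f1) + (d1 * f1 + (dv - dm) * f2)) -
     ((d2m * fm + d1m * f1m) + (d1m * f1m + (dm - dm) * f2m))| ≤ C * e + 6 * C ^ 2 * r := by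
  have hr : 0 ≤ C * r := (abs_nonneg _).trans l1
  have t : ∀ x y a b : ℝ, |x| ≤ a → |y| ≤ b → |x * y| ≤ a * b := fun x y a b hx hy => by
    rw [abs_mul]; exact mul_le_mul hx hy (abs_nonneg _) ((abs_nonneg _).trans hx)
  have a1 := abs_le.1 (t _ _ _ _ l5 b1)
  have a2 := abs_le.1 (t _ _ _ _ b2 l1)
  have a3 := abs_le.1 (t _ _ _ _ b3 l2)
  have a4 := abs_le.1 (t _ _ _ _ l3 b4)
  have a5 := abs_le.1 (t _ _ _ _ l4 b5)
  have hr2 : 0 ≤ C * (C * r) := mul_nonneg hC hr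
  rw [abs_le]
  constructor <;> nlinarith

set_option maxHeartbeats 1000000

/-- **Theorem 6, continuous mediator: kernel bias of the smoothed
controlled-effect influence function**: fix `g ∈ {0,1}` and `m ∈ ℝ`, set
`τ̄ := E[δ(g,m,X) | G=1]` and
`φ̄_h(g,m) = 1{G=g}·K_h(M−m)·(π(X)/(P(G=g|X)·f(m|g,X)))·(ΔY − δ(g,m,X))/p
            + (G/p)·(δ(g,m,X) − τ̄)` with `K_h(u) = h⁻¹K(u/h)`.
Then, as `h → 0⁺`, `E[φ̄_h(g,m)] = bias(g,m)·h² + o(h²)`, where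
`bias(g,m) = (μ₂(K)/(2p))·E[(π(X)/f(m|g,X))·∂²/∂v²{(δ(g,v,X) − δ(g,m,X))·f(v|g,X)}|_{v=m}]`
and `μ₂(K) = ∫ u² K(u) du`. -/
theorem smoothed_controlled_eif_kernel_bias
    {Ω 𝓧 : Type*} [MeasurableSpace Ω] [MeasurableSpace 𝓧]
    (P : Measure Ω) [IsProbabilityMeasure P]
    (G : Ω → ℝ) (hGmeas : Measurable G) (hG01 : ∀ ω, G ω = 0 ∨ G ω = 1)
    (hp0 : 0 < P {ω | G ω = 1}) (hp1 : P {ω | G ω = 1} < 1)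
    (X : Ω → 𝓧) (hXmeas : Measurable X)
    (M : Ω → ℝ) (hMmeas : Measurable M)
    (ΔY : Ω → ℝ) (hΔYmeas : Measurable ΔY) (hΔYint : Integrable ΔY P)
    -- fixed treatment level and mediator value
    (g m : ℝ) (hg : g = 0 ∨ g = 1)
    (c : ℝ) (hc : 0 < c)
    -- π(x), a measurable version of P(G=1 ∣ X=x)
    (π : 𝓧 → ℝ) (hπmeas : Measurable π)
    (hπver : (fun ω => π (X ω)) =ᵐ[P] P[G | MeasurableSpace.comap X inferInstance])
    -- pg(x), a measurable version of P(G=g ∣ X=x), with pg(X) ≥ c a.s.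
    (pg : 𝓧 → ℝ) (hpgmeas : Measurable pg)
    (hpgver : (fun ω => pg (X ω)) =ᵐ[P]
      P[fun ω' => if G ω' = g then (1 : ℝ) else 0 | MeasurableSpace.comap X inferInstance])
    (hpgc : ∀ᵐ ω ∂P, c ≤ pg (X ω))
    -- f(v∣g,x), a jointly measurable conditional Lebesgue density of M given (G=g, X=x)
    (f : ℝ → 𝓧 → ℝ) (hfmeas : Measurable (fun p : ℝ × 𝓧 => f p.1 p.2))
    (hdens : ∀ h : ℝ → ℝ, Measurable h → (∃ C, ∀ v, |h v| ≤ C) →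
      (P[fun ω => h (M ω) * (if G ω = g then (1 : ℝ) else 0) |
          MeasurableSpace.comap X inferInstance]
        =ᵐ[P] fun ω => pg (X ω) * ∫ v, h v * f v (X ω)))
    -- f(·∣g,x) is bounded below by c in a neighborhood of m
    (hflow : ∃ ε > (0 : ℝ), ∀ᵐ ω ∂P, ∀ v, |v - m| ≤ ε → c ≤ f v (X ω))
    -- δ(g,v,x), a version of E[ΔY ∣ G=g, M=v, X=x]
    (δ : ℝ → 𝓧 → ℝ) (hδmeas : Measurable (fun p : ℝ × 𝓧 => δ p.1 p.2))
    (hδver : (fun ω => (if G ω = g then (1 : ℝ) else 0) * δ (M ω) (X ω)) =ᵐ[P]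
      fun ω => (if G ω = g then (1 : ℝ) else 0) *
        (P[ΔY | MeasurableSpace.comap (fun ω' => (G ω', M ω', X ω')) inferInstance]) ω)
    -- smoothness of v ↦ δ(g,v,x) and v ↦ f(v∣g,x)
    (hsmooth : ∀ x, ContDiff ℝ 2 (fun v => δ v x) ∧ ContDiff ℝ 2 (fun v => f v x))
    -- uniform boundedness (part of the dominated-convergence requirements)
    (hbdd : ∃ C, ∀ x v, |δ v x| ≤ C ∧ |f v x| ≤ C ∧
      |iteratedDeriv 1 (fun w => δ w x) v| ≤ C ∧ |iteratedDeriv 1 (fun w => f w x) v| ≤ C ∧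
      |iteratedDeriv 2 (fun w => δ w x) v| ≤ C ∧ |iteratedDeriv 2 (fun w => f w x) v| ≤ C)
    -- second derivatives uniformly continuous at v = m, uniformly in x
    (huc : ∀ ε > (0 : ℝ), ∃ η > (0 : ℝ), ∀ x v, |v - m| < η →
      |iteratedDeriv 2 (fun w => δ w x) v - iteratedDeriv 2 (fun w => δ w x) m| < ε ∧
      |iteratedDeriv 2 (fun w => f w x) v - iteratedDeriv 2 (fun w => f w x) m| < ε)
    -- symmetric kernel with the dominated-convergence bounds needed for the expansion
    (K : ℝ → ℝ) (hKmeas : Measurable K) (hKsymm : ∀ u, K (-u) = K u)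
    (hK1 : ∫ u, K u = 1) (hK2 : Integrable (fun u => u ^ 2 * |K u|))
    (hKbdd : ∃ CK, ∀ u, |K u| ≤ CK) (hKsupp : HasCompactSupport K)
    -- τ̄ = E[δ(g,m,X) | G=1] and the kernel bias term
    (p : ℝ) (hp : p = (P {ω | G ω = 1}).toReal)
    (τb : ℝ) (hτb : τb = (∫ ω, G ω * δ m (X ω) ∂P) / p)
    (bias : ℝ)
    (hbias : bias = ((∫ u, u ^ 2 * K u) / (2 * p)) *
      ∫ ω, (π (X ω) / f m (X ω)) *
        iteratedDeriv 2 (fun v => (δ v (X ω) - δ m (X ω)) * f v (X ω)) m ∂P) :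
    Tendsto (fun h : ℝ =>
        ((∫ ω, ((if G ω = g then (1 : ℝ) else 0) * ((1 / h) * K ((M ω - m) / h))
            * (π (X ω) / (pg (X ω) * f m (X ω))) * (ΔY ω - δ m (X ω)) / p
          + (G ω / p) * (δ m (X ω) - τb)) ∂P) - bias * h ^ 2) / h ^ 2)
      (𝓝[>] (0 : ℝ)) (𝓝 0) := by
  obtain ⟨C, hC⟩ := hbdd
  obtain ⟨ε0, hε0, hflow⟩ := hflow
  obtain ⟨B, hB⟩ := hKsupp.isCompact.isBounded.exists_norm_le
  have hB' : ∀ u, K u ≠ 0 → |u| ≤ |B| := fun u hu =>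
    (hB u (subset_tsupport K hu)).trans (le_abs_self B)
  have hΩ : Nonempty Ω := by
    by_contra h
    rw [not_nonempty_iff] at h
    have := hp0
    simp [Measure.eq_zero_of_isEmpty P] at this
  have hC0 : 0 ≤ C := by
    obtain ⟨ω⟩ := hΩ
    exact (abs_nonneg _).trans (hC (X ω) m).1
  have hppos : 0 < p := by
    rw [hp]; exact ENNReal.toReal_pos hp0.ne' (measure_ne_top _ _)
  -- a.e. bounds
  have hπ1 : ∀ᵐ ω ∂P, |π (X ω)| ≤ 1 := by
    have := ae_bdd_abs_condExp_of_ae_bdd_abs (R := 1) (m := MeasurableSpace.comap X inferInstance)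
      (μ := P) (f := G) (ae_of_all _ fun ω => by rcases hG01 ω with h | h <;> simp [h])
    filter_upwards [this, hπver] with ω h1 h2
    rw [h2]; simpa using h1
  have hpg1 : ∀ᵐ ω ∂P, pg (X ω) ≤ 1 := by
    have := ae_bdd_abs_condExp_of_ae_bdd_abs (R := 1) (m := MeasurableSpace.comap X inferInstance)
      (μ := P) (f := fun ω' => if G ω' = g then (1 : ℝ) else 0)
      (ae_of_all _ fun ω => by by_cases h : G ω = g <;> simp [h])
    filter_upwards [this, hpgver] with ω h1 h2
    rw [h2]; exact (le_abs_self _).trans (by simpa using h1)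
  have hfm : ∀ᵐ ω ∂P, c ≤ f m (X ω) := by
    filter_upwards [hflow] with ω h
    exact h m (by simpa using hε0.le)
  -- derivatives
  set δ1 : 𝓧 → ℝ → ℝ := fun x => iteratedDeriv 1 (fun w => δ w x) with hδ1
  set δ2 : 𝓧 → ℝ → ℝ := fun x => iteratedDeriv 2 (fun w => δ w x) with hδ2
  set f1 : 𝓧 → ℝ → ℝ := fun x => iteratedDeriv 1 (fun w => f w x) with hf1
  set f2 : 𝓧 → ℝ → ℝ := fun x => iteratedDeriv 2 (fun w => f w x) with hf2
  have dδ := fun x => aux_derivs _ (hsmooth x).1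
  have df := fun x => aux_derivs _ (hsmooth x).2
  set ψ : 𝓧 → ℝ → ℝ := fun x v => (δ v x - δ m x) * f v x with hψ
  set ψ1 : 𝓧 → ℝ → ℝ := fun x v => δ1 x v * f v x + (δ v x - δ m x) * f1 x v with hψ1
  set ψ2 : 𝓧 → ℝ → ℝ := fun x v =>
    (δ2 x v * f v x + δ1 x v * f1 x v) + (δ1 x v * f1 x v + (δ v x - δ m x) * f2 x v) with hψ2
  have dψ := fun x => aux_prod_derivs (fun v => δ v x) (δ1 x) (δ2 x) (fun v => f v x) (f1 x) (f2 x)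
    (δ m x) (dδ x).1 (dδ x).2 (df x).1 (df x).2
  have dψ0 : ∀ x v, HasDerivAt (ψ x) (ψ1 x v) v := fun x => (dψ x).1
  have dψ1 : ∀ x v, HasDerivAt (ψ1 x) (ψ2 x v) v := fun x => (dψ x).2
  have hψm : ∀ x, ψ x m = 0 := fun x => by simp [hψ]
  have hit : ∀ x, iteratedDeriv 2 (fun v => (δ v x - δ m x) * f v x) m = ψ2 x m := by
    intro x
    rw [show (2 : ℕ) = 1 + 1 from rfl, iteratedDeriv_succ, iteratedDeriv_one]
    have : deriv (fun v => (δ v x - δ m x) * f v x) = ψ1 x := funext fun v => (dψ0 x v).deriv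
    rw [this]
    exact (dψ1 x m).deriv
  have hunif : ∀ e > 0, ∃ η > (0:ℝ), ∀ x v, |v - m| < η → |ψ2 x v - ψ2 x m| ≤ e := by
    intro e he
    obtain ⟨η, hη, hh⟩ := huc (e / (2 * (C + 1))) (by positivity)
    refine ⟨min η (e / (12 * (C ^ 2 + 1))), lt_min hη (by positivity), fun x v hv => ?_⟩
    have hv1 := lt_of_lt_of_le hv (min_le_left _ _)
    have hv2 := lt_of_lt_of_le hv (min_le_right _ _)
    have key := aux_psi2 (δ1 x v) (δ2 x v) (f v x) (f1 x v) (δ2 x m) (δ1 x m) (f m x) (f1 x m)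
      (δ m x) (δ v x) (f2 x v) C |v - m| (e / (2 * (C + 1))) hC0
      (hC x v).2.1 (hC x m).2.2.2.2.1 (hC x v).2.2.1 (hC x m).2.2.2.1 (hC x v).2.2.2.2.2
      (aux_lip _ _ (df x).1 C (fun w => (hC x w).2.2.2.1) v m)
      (aux_lip _ _ (df x).2 C (fun w => (hC x w).2.2.2.2.2) v m)
      (aux_lip _ _ (dδ x).2 C (fun w => (hC x w).2.2.2.2.1) v m)
      (aux_lip _ _ (dδ x).1 C (fun w => (hC x w).2.2.1) v m)
      (hh x v hv1).1.le (f2 x m)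
    refine key.trans ?_
    have k1 : C * (e / (2 * (C + 1))) ≤ e / 2 := by
      rw [← mul_div_assoc, div_le_div_iff₀ (by positivity) (by norm_num)]
      nlinarith
    have k2 : 6 * C ^ 2 * |v - m| ≤ e / 2 := by
      rw [lt_div_iff₀ (by positivity)] at hv2
      nlinarith [abs_nonneg (v - m), sq_nonneg C]
    linarith
  have hψ2b : ∀ x, |ψ2 x m| ≤ 3 * C ^ 2 := by
    intro x
    obtain ⟨-, b1, b2, b3, b4, -⟩ := hC x m
    have t : ∀ x y : ℝ, |x| ≤ C → |y| ≤ C → |x * y| ≤ C * C := fun x y hx hy => by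
      rw [abs_mul]; exact mul_le_mul hx hy (abs_nonneg _) hC0
    have a1 := abs_le.1 (t _ _ b4 b1)
    have a2 := abs_le.1 (t _ _ b2 b3)
    simp only [hψ2, sub_self, zero_mul, add_zero]
    rw [abs_le]
    constructor <;> simp only [hδ1, hδ2, hf1] <;> nlinarith
  -- measurability
  have hδv : ∀ v, Measurable (fun x => δ v x) := fun v =>
    hδmeas.comp (measurable_const.prodMk measurable_id)
  have hfv : ∀ v, Measurable (fun x => f v x) := fun v =>
    hfmeas.comp (measurable_const.prodMk measurable_id)
  have hψv : ∀ v, Measurable (fun x => ψ x v) := fun v => ((hδv v).sub (hδv m)).mul (hfv v)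
  have hψ2m : Measurable (fun x => ψ2 x m) := by
    have hs : Tendsto (fun n : ℕ => 1 / ((n : ℝ) + 1)) atTop (𝓝 0) :=
      tendsto_one_div_add_atTop_nhds_zero_nat
    refine measurable_of_tendsto_metrizable (f := fun (n : ℕ) x =>
      (ψ x (m + 1 / ((n : ℝ) + 1)) + ψ x (m + -(1 / ((n : ℝ) + 1)))) / (1 / ((n : ℝ) + 1)) ^ 2)
      (fun n => ((hψv _).add (hψv _)).div_const _) ?_
    rw [tendsto_pi_nhds]
    intro x
    rw [Metric.tendsto_nhds]
    intro e he
    obtain ⟨η, hη, hh⟩ := hunif (e / 4) (by positivity)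
    filter_upwards [hs.eventually (gt_mem_nhds hη)] with n hn
    set s : ℝ := 1 / ((n : ℝ) + 1) with hsdef
    have hspos : 0 < s := by positivity
    have c1 := aux_taylor (ψ x) (ψ1 x) (ψ2 x) (dψ0 x) (dψ1 x) m η (e / 4) (hh x) s
      (by rwa [abs_of_pos hspos])
    have c2 := aux_taylor (ψ x) (ψ1 x) (ψ2 x) (dψ0 x) (dψ1 x) m η (e / 4) (hh x) (-s)
      (by rwa [abs_neg, abs_of_pos hspos])
    rw [hψm] at c1 c2
    rw [Real.dist_eq]
    have hs2 : 0 < s ^ 2 := by positivity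
    have : (ψ x (m + s) + ψ x (m + -s)) / s ^ 2 - ψ2 x m
        = (ψ x (m + s) + ψ x (m + -s) - ψ2 x m * s ^ 2) / s ^ 2 := by
      field_simp
    rw [this, abs_div, abs_of_pos hs2, div_lt_iff₀ hs2]
    rw [abs_le] at c1 c2
    rw [abs_lt]
    constructor <;> nlinarith
  -- the representation
  have hrep : ∀ h : ℝ, 0 < h → h * |B| ≤ ε0 →
      (∫ ω, ((if G ω = g then (1 : ℝ) else 0) * ((1 / h) * K ((M ω - m) / h))
            * (π (X ω) / (pg (X ω) * f m (X ω))) * (ΔY ω - δ m (X ω)) / p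
          + (G ω / p) * (δ m (X ω) - τb)) ∂P)
      = (1 / p) * ∫ ω, (π (X ω) / f m (X ω)) *
          (∫ v, (1 / h * K ((v - m) / h)) * ψ (X ω) v) ∂P := by
    intro h hh hhB
    obtain ⟨CK, hCK⟩ := hKbdd
    have hCK0 : 0 ≤ CK := (abs_nonneg _).trans (hCK 0)
    set B0 : 𝓧 × ℝ → ℝ := fun z =>
      ((1 / h) * K ((z.2 - m) / h)) * (π z.1 / (pg z.1 * f m z.1)) with hB0
    have hB0m : Measurable B0 := by
      have h1 : Measurable (fun z : 𝓧 × ℝ => K ((z.2 - m) / h)) :=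
        hKmeas.comp ((measurable_snd.sub_const m).div_const h)
      exact (h1.const_mul _).mul ((hπmeas.comp measurable_fst).div
        ((hpgmeas.comp measurable_fst).mul ((hfv m).comp measurable_fst)))
    have hB0b : ∀ᵐ ω ∂P, |B0 (X ω, M ω)| ≤ (1 / h * CK) * (1 / (c * c)) := by
      filter_upwards [hπ1, hpgc, hfm] with ω h1 h2 h3
      simp only [hB0]
      rw [abs_mul, abs_mul, abs_of_pos (one_div_pos.2 hh), abs_div (π (X ω)),
        abs_of_pos (mul_pos (hc.trans_le h2) (hc.trans_le h3))]
      have hq0 : 0 < pg (X ω) * f m (X ω) := mul_pos (hc.trans_le h2) (hc.trans_le h3)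
      refine mul_le_mul (mul_le_mul_of_nonneg_left (hCK _) (by positivity)) ?_
        (div_nonneg (abs_nonneg _) hq0.le) (by positivity)
      exact div_le_div₀ zero_le_one h1 (by positivity)
        (mul_le_mul h2 h3 hc.le (hc.le.trans h2))
    have htow := aux_tower P G hGmeas X hXmeas M hMmeas ΔY hΔYint g δ hδver B0 hB0m _ hB0b
    have hdis := aux_disint P G hGmeas X hXmeas M hMmeas g m c hc pg hpgmeas hpgc hpg1 f hfmeas
      hdens ε0 hflow C (fun x v => (hC x v).2.1)
      (fun z => B0 z * (δ z.2 z.1 - δ m z.1))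
      (hB0m.mul ((hδmeas.comp (measurable_snd.prodMk measurable_fst)).sub
        ((hδv m).comp measurable_fst)))
      (by
        intro x v hv
        have : K ((v - m) / h) = 0 := by
          by_contra hne
          apply hv
          have := hB' _ hne
          rw [abs_div, abs_of_pos hh, div_le_iff₀ hh] at this
          linarith
        simp [hB0, this])
      ((1 / h * CK) * (1 / (c * c)) * (2 * C))
      (by
        filter_upwards [hB0b] with ω h1
        rw [abs_mul]
        have : |δ (M ω) (X ω) - δ m (X ω)| ≤ 2 * C := by
          have a1 := abs_le.1 (hC (X ω) (M ω)).1
          have a2 := abs_le.1 (hC (X ω) m).1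
          rw [abs_le]; constructor <;> linarith
        exact mul_le_mul h1 this (abs_nonneg _) ((abs_nonneg _).trans h1))
    have hAm : Measurable (fun ω => (if G ω = g then (1 : ℝ) else 0) * B0 (X ω, M ω)) :=
      (Measurable.ite (hGmeas (measurableSet_singleton g)) measurable_const
        measurable_const).mul (hB0m.comp (hXmeas.prodMk hMmeas))
    have hAint : ∀ q : Ω → ℝ, Measurable q → (∀ ω, |q ω| ≤ C) →
        Integrable (fun ω => (if G ω = g then (1 : ℝ) else 0) * B0 (X ω, M ω) * q ω) P := by
      intro q hq hqC
      refine Integrable.of_bound (C := (1 / h * CK) * (1 / (c * c)) * C)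
        (hAm.mul hq).aestronglyMeasurable ?_
      filter_upwards [hB0b] with ω h1
      rw [norm_mul]
      refine mul_le_mul ?_ (hqC ω) (norm_nonneg _) ((abs_nonneg _).trans h1)
      rw [Real.norm_eq_abs, abs_mul]
      refine le_trans ?_ h1
      by_cases h : G ω = g <;> simp [h]
    have i1 := hAint (fun ω => δ (M ω) (X ω)) (hδmeas.comp (hMmeas.prodMk hXmeas))
      (fun ω => (hC _ _).1)
    have i2 := hAint (fun ω => δ m (X ω)) ((hδv m).comp hXmeas) (fun ω => (hC _ _).1)
    have hGint : Integrable G P := Integrable.of_bound (C := 1) hGmeas.aestronglyMeasurable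
      (ae_of_all _ fun ω => by rcases hG01 ω with h | h <;> simp [h])
    have hGδ : Integrable (fun ω => G ω * δ m (X ω)) P :=
      hGint.mul_bdd (c := C) ((hδv m).comp hXmeas).aestronglyMeasurable
        (ae_of_all _ fun ω => (hC _ _).1)
    have hEG : ∫ ω, G ω ∂P = p := by
      have : G = ({ω | G ω = 1}).indicator 1 := by
        funext ω
        by_cases h : G ω = 1
        · rw [Set.indicator_of_mem (show ω ∈ {ω | G ω = 1} from h), h]; rfl
        · rw [Set.indicator_of_notMem (show ω ∉ {ω | G ω = 1} from h)]
          exact (hG01 ω).resolve_right h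
      rw [hp]
      conv_lhs => rw [this]
      have hm1 : MeasurableSet {ω | G ω = 1} := hGmeas (measurableSet_singleton 1)
      rw [integral_indicator_one hm1]
      rfl
    have hzero : ∫ ω, (G ω * δ m (X ω) - τb * G ω) ∂P = 0 := by
      rw [integral_sub hGδ (hGint.const_mul _), integral_const_mul, hEG, hτb]
      field_simp
      ring
    have hsplit : ∀ ω, (if G ω = g then (1 : ℝ) else 0) * ((1 / h) * K ((M ω - m) / h))
            * (π (X ω) / (pg (X ω) * f m (X ω))) * (ΔY ω - δ m (X ω)) / p
          + (G ω / p) * (δ m (X ω) - τb)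
        = (1 / p) * (((if G ω = g then (1 : ℝ) else 0) * B0 (X ω, M ω) * ΔY ω
           - (if G ω = g then (1 : ℝ) else 0) * B0 (X ω, M ω) * δ m (X ω))
          + (G ω * δ m (X ω) - τb * G ω)) := by
      intro ω
      simp only [hB0]
      ring
    simp only [hsplit]
    rw [integral_const_mul, integral_add (f := fun ω =>
      (if G ω = g then (1 : ℝ) else 0) * B0 (X ω, M ω) * ΔY ω
           - (if G ω = g then (1 : ℝ) else 0) * B0 (X ω, M ω) * δ m (X ω))
      (g := fun ω => G ω * δ m (X ω) - τb * G ω)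
      (htow.1.sub i2) (hGδ.sub (hGint.const_mul _)), hzero, add_zero,
      integral_sub htow.1 i2, htow.2, ← integral_sub i1 i2]
    congr 1
    calc _ = ∫ ω, (if G ω = g then (1 : ℝ) else 0) *
          (B0 (X ω, M ω) * (δ (M ω) (X ω) - δ m (X ω))) ∂P := by
          congr 1; funext ω; ring
      _ = _ := hdis
      _ = _ := by
        refine integral_congr_ae ?_
        filter_upwards [hpgc, hfm] with ω h1 h2
        rw [← integral_const_mul, ← integral_const_mul]
        congr 1; funext v
        simp only [hB0, hψ]
        have n1 : pg (X ω) ≠ 0 := (hc.trans_le h1).ne'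
        have n2 : f m (X ω) ≠ 0 := (hc.trans_le h2).ne'
        field_simp
  -- conclusion
  set L : ℝ := ∫ u, u ^ 2 * |K u| with hL
  have hL0 : 0 ≤ L := integral_nonneg fun u => by positivity
  set μ2 : ℝ := ∫ u, u ^ 2 * K u with hμ2
  rw [Metric.tendsto_nhds]
  intro e he
  set e' : ℝ := e * p * c / (2 * (L + 1)) with he'
  have he'0 : 0 < e' := by positivity
  obtain ⟨η, hη, hψη⟩ := hunif e' he'0
  have hmin : 0 < min η ε0 / (|B| + 1) := div_pos (lt_min hη hε0) (by positivity)
  filter_upwards [self_mem_nhdsWithin, nhdsWithin_le_nhds (gt_mem_nhds hmin)] with h hh hhm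
  have hh : 0 < h := hh
  rw [lt_div_iff₀ (by positivity)] at hhm
  have hhB : h * |B| < min η ε0 := by nlinarith
  have hh1 := lt_of_lt_of_le hhB (min_le_left _ _)
  have hh2 := (lt_of_lt_of_le hhB (min_le_right _ _)).le
  rw [hrep h hh hh2]
  set J : 𝓧 → ℝ := fun x => ∫ v, (1 / h * K ((v - m) / h)) * ψ x v with hJ
  have hker : ∀ x, |J x - h ^ 2 / 2 * ψ2 x m * μ2| ≤ e' * h ^ 2 * L := fun x =>
    aux_kernel K hKmeas hKsymm hKbdd hKsupp |B| hB' (ψ x) (ψ1 x) (ψ2 x) (dψ0 x) (dψ1 x) m η e'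
      (hψm x) (hψη x) h hh hh1
  have hJm : Measurable J := by
    have hm : Measurable (fun z : 𝓧 × ℝ => (1 / h * K ((z.2 - m) / h)) * ψ z.1 z.2) := by
      have h1 : Measurable (fun z : 𝓧 × ℝ => K ((z.2 - m) / h)) :=
        hKmeas.comp ((measurable_snd.sub_const m).div_const h)
      refine (h1.const_mul _).mul (Measurable.mul (Measurable.sub ?_ ?_) ?_)
      · exact hδmeas.comp (measurable_snd.prodMk measurable_fst)
      · exact (hδv m).comp measurable_fst
      · exact hfmeas.comp (measurable_snd.prodMk measurable_fst)
    exact (hm.stronglyMeasurable.integral_prod_right' (ν := volume)).measurable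
  have hwm : Measurable (fun ω => π (X ω) / f m (X ω)) :=
    (hπmeas.comp hXmeas).div ((hfv m).comp hXmeas)
  have hwb : ∀ᵐ ω ∂P, |π (X ω) / f m (X ω)| ≤ 1 / c := by
    filter_upwards [hπ1, hfm] with ω h1 h2
    rw [abs_div, abs_of_pos (hc.trans_le h2)]
    gcongr
  have hint : ∀ (q : 𝓧 → ℝ) (D : ℝ), Measurable q → (∀ x, |q x| ≤ D) →
      Integrable (fun ω => π (X ω) / f m (X ω) * q (X ω)) P := by
    intro q D hq hD
    refine Integrable.of_bound (C := 1 / c * D) (hwm.mul (hq.comp hXmeas)).aestronglyMeasurable ?_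
    filter_upwards [hwb] with ω h1
    rw [norm_mul]
    exact mul_le_mul h1 (hD _) (norm_nonneg _) (by positivity)
  have iψ := hint (fun x => ψ2 x m) _ hψ2m hψ2b
  have iD := hint (fun x => J x - h ^ 2 / 2 * ψ2 x m * μ2) _
    (hJm.sub ((hψ2m.const_mul _).mul_const _)) hker
  have hdiff : (1 / p) * (∫ ω, (π (X ω) / f m (X ω)) * J (X ω) ∂P) - bias * h ^ 2
      = (1 / p) * ∫ ω, π (X ω) / f m (X ω) * (J (X ω) - h ^ 2 / 2 * ψ2 (X ω) m * μ2) ∂P := by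
    have : ∀ ω, π (X ω) / f m (X ω) * J (X ω) =
        π (X ω) / f m (X ω) * (J (X ω) - h ^ 2 / 2 * ψ2 (X ω) m * μ2)
        + (h ^ 2 / 2 * μ2) * (π (X ω) / f m (X ω) * ψ2 (X ω) m) := by intro ω; ring
    simp only [this]
    rw [integral_add iD (iψ.const_mul _), integral_const_mul, hbias]
    simp only [hit]
    generalize (∫ ω, π (X ω) / f m (X ω) * (J (X ω) - h ^ 2 / 2 * ψ2 (X ω) m * μ2) ∂P) = a1
    generalize (∫ ω, π (X ω) / f m (X ω) * ψ2 (X ω) m ∂P) = a2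
    field_simp
    ring
  have hbound : |∫ ω, π (X ω) / f m (X ω) * (J (X ω) - h ^ 2 / 2 * ψ2 (X ω) m * μ2) ∂P|
      ≤ 1 / c * (e' * h ^ 2 * L) := by
    have := norm_integral_le_of_norm_le_const (μ := P)
      (f := fun ω => π (X ω) / f m (X ω) * (J (X ω) - h ^ 2 / 2 * ψ2 (X ω) m * μ2))
      (C := 1 / c * (e' * h ^ 2 * L)) (by
        filter_upwards [hwb] with ω h1
        rw [norm_mul]
        exact mul_le_mul h1 (hker _) (norm_nonneg _) (by positivity))
    simpa using this
  rw [Real.dist_eq, sub_zero, hdiff, abs_div, abs_mul, abs_of_pos (one_div_pos.2 hppos),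
    abs_of_pos (by positivity : 0 < h ^ 2), div_lt_iff₀ (by positivity)]
  have hfin : 1 / p * (1 / c * (e' * h ^ 2 * L)) < e * h ^ 2 := by
    have : 1 / p * (1 / c * (e' * h ^ 2 * L)) = e * h ^ 2 * (L / (2 * (L + 1))) := by
      rw [he']; field_simp
    rw [this]
    have h3 : L / (2 * (L + 1)) < 1 := by
      rw [div_lt_one (by positivity)]; linarith
    have h4 : 0 < e * h ^ 2 := by positivity
    exact mul_lt_of_lt_one_right h4 h3
  exact lt_of_le_of_lt (mul_le_mul_of_nonneg_left hbound (by positivity)) hfin
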